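/- For every τ ≥ (n+1)/n, the set W(ψ_τ) of x ∈ ℝⁿ admitting infinitely many rational approximations p/q with ‖x − p/q‖ < q^{−τ} has Hausdorff dimension (n+1)/τ. -/

import Mathlib

open Real Filter MeasureTheory

/-- The set `W(ψ)` of `ψ`-approximable points of `ℝⁿ` (sup norm): those `x` admitting
infinitely many rational points `v = p/q ∈ ℚⁿ` with `‖x - p/q‖ < ψ(q)`, where `q` is the
reduced common denominator of `v`. -/
def Wapprox (n : ℕ) (ψ : ℕ → ℝ) : Set (Fin n → ℝ) :=
  {x | {v : Fin n → ℚ |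
      ‖x - fun i => (v i : ℝ)‖ < ψ (Finset.univ.lcm fun i => (v i).den)}.Infinite}

/-- The set `E(ψ) = W(ψ) \ ⋃_{0<c<1} W(cψ)` of exactly `ψ`-approximable points. -/
def Eapprox (n : ℕ) (ψ : ℕ → ℝ) : Set (Fin n → ℝ) :=
  Wapprox n ψ \ ⋃ c ∈ Set.Ioo (0 : ℝ) 1, Wapprox n (fun q => c * ψ q)

/-- The reduced common denominator of a rational point. -/
def commonDen {n : ℕ} (v : Fin n → ℚ) : ℕ := Finset.univ.lcm fun i => (v i).den

/-- A rational point, viewed in `ℝⁿ`. -/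
def realPoint {n : ℕ} (v : Fin n → ℚ) : Fin n → ℝ := fun i => (v i : ℝ)

/-- The points `p / q` with `p ∈ ℤⁿ` in the closed ball of centre `x` and radius `R`. -/
noncomputable def gridPoints {n : ℕ} (q : ℕ) (x : Fin n → ℝ) (R : ℝ) : Finset (Fin n → ℚ) :=
  (Fintype.piFinset fun i => Finset.Icc ⌈q * (x i - R)⌉ ⌊q * (x i + R)⌋).image
    fun p i => (p i : ℚ) / q

lemma commonDen_pos {n : ℕ} (v : Fin n → ℚ) : 0 < commonDen v := by
  refine Nat.pos_of_ne_zero fun h => ?_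
  obtain ⟨i, -, hi⟩ := Finset.lcm_eq_zero_iff.1 h
  exact (v i).den_nz hi

lemma commonDen_dvd_of_eq_div {n : ℕ} {v : Fin n → ℚ} {q : ℕ} (p : Fin n → ℤ)
    (h : ∀ i, v i = p i / q) : commonDen v ∣ q := by
  refine Finset.lcm_dvd fun i _ => ?_
  have := Rat.den_dvd (p i) q
  rw [h i]
  exact_mod_cast this

lemma exists_eq_div_commonDen {n : ℕ} (v : Fin n → ℚ) :
    ∃ p : Fin n → ℤ, ∀ i, v i = p i / commonDen v := by
  have h (i : Fin n) : ∃ k : ℤ, v i = k / commonDen v := by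
    obtain ⟨c, hc⟩ : (v i).den ∣ commonDen v := Finset.dvd_lcm (Finset.mem_univ i)
    have hpos := commonDen_pos v
    have hc0 : (c : ℚ) ≠ 0 := by
      rintro h0
      rw [Nat.cast_eq_zero] at h0
      simp [h0] at hc
      omega
    refine ⟨(v i).num * c, ?_⟩
    rw [hc]
    push_cast
    rw [mul_div_mul_right _ _ hc0, Rat.num_div_den]
  choose p hp using h
  exact ⟨p, hp⟩

lemma mem_gridPoints {n : ℕ} {v : Fin n → ℚ} {x : Fin n → ℝ} {R : ℝ} (hR : 0 ≤ R)
    (h : realPoint v ∈ Metric.closedBall x R) : v ∈ gridPoints (commonDen v) x R := by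
  obtain ⟨p, hp⟩ := exists_eq_div_commonDen v
  have hq : (0 : ℝ) < commonDen v := by exact_mod_cast commonDen_pos v
  refine Finset.mem_image.2 ⟨p, ?_, funext fun i => (hp i).symm⟩
  rw [Fintype.mem_piFinset]
  intro i
  rw [Metric.mem_closedBall, dist_pi_le_iff hR] at h
  have hi := h i
  rw [Real.dist_eq, abs_le] at hi
  have hpi : (p i : ℝ) = commonDen v * realPoint v i := by
    have : (realPoint v i : ℝ) = (p i : ℝ) / commonDen v := by
      simp only [realPoint]
      conv_lhs => rw [hp i]
      push_cast
      rfl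
    rw [this]
    field_simp
  rw [Finset.mem_Icc, Int.ceil_le, Int.le_floor, hpi]
  constructor <;> gcongr <;> linarith

lemma card_gridPoints_le {n : ℕ} (q : ℕ) (x : Fin n → ℝ) {R : ℝ} (hR : 0 ≤ R) :
    ((gridPoints q x R).card : ℝ) ≤ (2 * q * R + 1) ^ n := by
  have h1 : ((gridPoints q x R).card : ℝ) ≤
      ∏ i, ((Finset.Icc ⌈q * (x i - R)⌉ ⌊q * (x i + R)⌋).card : ℝ) := by
    rw [← Nat.cast_prod, ← Fintype.card_piFinset]
    exact_mod_cast Finset.card_image_le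
  refine h1.trans ?_
  have h2 : (2 * q * R + 1) ^ n = ∏ _i : Fin n, (2 * q * R + 1) := by simp
  rw [h2]
  refine Finset.prod_le_prod (fun _ _ => Nat.cast_nonneg _) fun i _ => ?_
  have h0 : 0 ≤ 2 * q * R + 1 := by positivity
  rw [Int.card_Icc, ← Int.cast_natCast, Int.toNat_eq_max, Int.cast_max]
  refine max_le ?_ (by simpa using h0)
  have := Int.floor_le (q * (x i + R))
  have := Int.le_ceil (q * (x i - R))
  push_cast
  linarith

/-- Dirichlet's theorem on simultaneous approximation. -/
lemma exists_commonDen_le_dist_lt {n : ℕ} (x : Fin n → ℝ) {N : ℕ} (hN : 0 < N) :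
    ∃ v : Fin n → ℚ, commonDen v ≤ N ^ n ∧
      dist x (realPoint v) < 1 / (commonDen v * N) := by
  have hN' : (0 : ℝ) < N := by exact_mod_cast hN
  let f : ℕ → Fin n → ℕ := fun q i => ⌊N * Int.fract (q * x i)⌋₊
  have hf : ∀ q ∈ Finset.range (N ^ n + 1),
      f q ∈ Fintype.piFinset fun _ : Fin n => Finset.range N := by
    intro q _
    rw [Fintype.mem_piFinset]
    intro i
    rw [Finset.mem_range, Nat.floor_lt (by positivity)]
    nlinarith [Int.fract_lt_one (q * x i)]
  obtain ⟨a, ha, b, hb, hab, hfab⟩ :=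
    Finset.exists_ne_map_eq_of_card_lt_of_maps_to (by simp) hf
  wlog hlt : a < b generalizing a b
  · exact this b hb a ha hab.symm hfab.symm (by omega)
  rw [Finset.mem_range] at hb
  obtain ⟨q, rfl⟩ := Nat.exists_eq_add_of_lt hlt
  let p : Fin n → ℤ := fun i => ⌊((a + q + 1 : ℕ) : ℝ) * x i⌋ - ⌊(a : ℝ) * x i⌋
  let v : Fin n → ℚ := fun i => (p i : ℚ) / (q + 1 : ℕ)
  have hdvd : commonDen v ∣ q + 1 := commonDen_dvd_of_eq_div p fun i => rfl
  have hle : commonDen v ≤ q + 1 := Nat.le_of_dvd (by omega) hdvd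
  have hq : (0 : ℝ) < (q + 1 : ℕ) := by positivity
  have hden : (0 : ℝ) < commonDen v := by exact_mod_cast commonDen_pos v
  refine ⟨v, by omega, (?_ : _ < 1 / (((q + 1 : ℕ) : ℝ) * N)).trans_le ?_⟩
  · rw [dist_pi_lt_iff (by positivity)]
    intro i
    have h1 : f a i = f (a + q + 1) i := congrFun hfab i
    have ha1 := Nat.floor_le (a := N * Int.fract ((a : ℝ) * x i)) (by positivity)
    have ha2 := Nat.lt_floor_add_one (N * Int.fract ((a : ℝ) * x i))
    have hb1 := Nat.floor_le (a := N * Int.fract (((a + q + 1 : ℕ) : ℝ) * x i)) (by positivity)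
    have hb2 := Nat.lt_floor_add_one (N * Int.fract (((a + q + 1 : ℕ) : ℝ) * x i))
    simp only [f] at h1
    rw [h1] at ha1 ha2
    have hx : x i - realPoint v i = (Int.fract (((a + q + 1 : ℕ) : ℝ) * x i)
        - Int.fract ((a : ℝ) * x i)) / (q + 1 : ℕ) := by
      simp only [realPoint, v, p, Int.fract]
      push_cast
      field_simp
      ring
    rw [Real.dist_eq, hx, abs_div, abs_of_pos hq, div_lt_div_iff₀ hq (by positivity)]
    have : |Int.fract (((a + q + 1 : ℕ) : ℝ) * x i) - Int.fract ((a : ℝ) * x i)| * N < 1 := by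
      nth_rewrite 1 [← abs_of_pos hN']
      rw [← abs_mul, abs_lt]
      constructor <;> nlinarith
    nlinarith
  · gcongr

/-- A finite family of points contains a maximal `δ`-separated subfamily. -/
lemma exists_separated_subset {α X : Type*} [PseudoMetricSpace X] (f : α → X) (V : Finset α)
    {δ : ℝ} (hδ : 0 ≤ δ) :
    ∃ P ⊆ V, (∀ v ∈ P, ∀ w ∈ P, v ≠ w → δ < dist (f v) (f w)) ∧
      ∀ v ∈ V, ∃ w ∈ P, dist (f v) (f w) ≤ δ := by
  classical
  let sep : Finset α → Prop := fun P => ∀ v ∈ P, ∀ w ∈ P, v ≠ w → δ < dist (f v) (f w)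
  let F := V.powerset.filter sep
  obtain ⟨P, hPF, hmax⟩ := F.exists_max_image Finset.card ⟨∅, by simp [F, sep]⟩
  obtain ⟨hPV, hsep⟩ := Finset.mem_filter.1 hPF
  rw [Finset.mem_powerset] at hPV
  refine ⟨P, hPV, hsep, fun v hv => ?_⟩
  by_contra! hfar
  have hvP : v ∉ P := fun h => by
    have := hfar v h
    rw [dist_self] at this
    linarith
  have hins : insert v P ∈ F := by
    refine Finset.mem_filter.2 ⟨Finset.mem_powerset.2 (Finset.insert_subset hv hPV), ?_⟩
    intro a ha b hb hab
    rw [Finset.mem_insert] at ha hb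
    rcases ha with rfl | ha <;> rcases hb with rfl | hb
    · exact absurd rfl hab
    · exact hfar b hb
    · rw [dist_comm]
      exact hfar a ha
    · exact hsep a ha b hb hab
  have := hmax _ hins
  rw [Finset.card_insert_of_notMem hvP] at this
  omega

lemma sum_Icc_mul_add_one_pow_le (n K N : ℕ) {r : ℝ} (hr : 0 < r) :
    ∑ q ∈ Finset.Icc 1 K, ((q : ℝ) * r + 1) ^ n * (2 * (1 / (q * N))) ^ n
      ≤ (2 / N) ^ n * (K * (2 * r) ^ n + 2 ^ n / r) := by
  have hterm : ∀ q ∈ Finset.Icc 1 K, ((q : ℝ) * r + 1) ^ n * (2 * (1 / (q * N))) ^ n ≤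
      (2 / N) ^ n * ((2 * r) ^ n + if (q : ℝ) * r ≤ 1 then 2 ^ n else 0) := by
    intro q hq
    have hq1 : (1 : ℝ) ≤ q := by exact_mod_cast (Finset.mem_Icc.1 hq).1
    have hq0 : (0 : ℝ) < q := by linarith
    have h1 : ((q : ℝ) * r + 1) ^ n * (2 * (1 / (q * N))) ^ n
        = (2 / N) ^ n * (r + 1 / q) ^ n := by
      rw [← mul_pow, ← mul_pow]
      congr 1
      rcases eq_or_ne (N : ℝ) 0 with h | h
      · simp [h]
      · field_simp
    rw [h1]
    gcongr
    split_ifs with h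
    · have h2 : r + 1 / q ≤ 2 := by
        have : r ≤ 1 := by nlinarith
        have : 1 / (q : ℝ) ≤ 1 := by rw [div_le_one hq0]; exact hq1
        linarith
      have : (r + 1 / q) ^ n ≤ 2 ^ n := by gcongr
      have : 0 ≤ (2 * r) ^ n := by positivity
      linarith
    · push Not at h
      rw [add_zero]
      gcongr
      have : 1 / (q : ℝ) ≤ r := by
        rw [div_le_iff₀ hq0]
        linarith
      linarith
  refine (Finset.sum_le_sum hterm).trans ?_
  rw [← Finset.mul_sum, Finset.sum_add_distrib, Finset.sum_const, Nat.card_Icc,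
    Nat.add_sub_cancel, nsmul_eq_mul, ← Finset.sum_filter, Finset.sum_const, nsmul_eq_mul]
  have hcard : (((Finset.Icc 1 K).filter fun q : ℕ => (q : ℝ) * r ≤ 1).card : ℝ) ≤ 1 / r := by
    have hsub : ((Finset.Icc 1 K).filter fun q : ℕ => (q : ℝ) * r ≤ 1) ⊆
        Finset.Icc 1 ⌊1 / r⌋₊ := by
      intro q hq
      rw [Finset.mem_filter, Finset.mem_Icc] at hq
      refine Finset.mem_Icc.2 ⟨hq.1.1, Nat.le_floor ?_⟩
      rw [le_div_iff₀ hr]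
      exact hq.2
    calc _ ≤ ((Finset.Icc 1 ⌊1 / r⌋₊).card : ℝ) := by exact_mod_cast Finset.card_le_card hsub
      _ = (⌊1 / r⌋₊ : ℝ) := by simp
      _ ≤ 1 / r := Nat.floor_le (by positivity)
  have : (2 : ℝ) ^ n / r = 1 / r * 2 ^ n := by ring
  rw [this]
  gcongr

lemma volume_biUnion_closedBall_le {n : ℕ} {ι : Type*} (s : Finset ι) (y : ι → Fin n → ℝ)
    {R : ℝ} (hR : 0 ≤ R) :
    volume (⋃ i ∈ s, Metric.closedBall (y i) R) ≤ ENNReal.ofReal (s.card * (2 * R) ^ n) := by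
  refine (measure_biUnion_finset_le _ _).trans ?_
  simp only [Real.volume_pi_closedBall _ hR, Fintype.card_fin, Finset.sum_const, nsmul_eq_mul]
  rw [ENNReal.ofReal_mul (by positivity), ENNReal.ofReal_natCast]

/-- Every ball contains many well separated rational points with small denominators. -/
lemma exists_separated_rationals {n : ℕ} (hn : 1 ≤ n) :
    ∃ c : ℝ, 0 < c ∧ ∀ (x : Fin n → ℝ) (r : ℝ), 0 < r → ∀ᶠ N : ℕ in atTop,
      ∃ P : Finset (Fin n → ℚ), (∀ v ∈ P, commonDen v ≤ N ^ n) ∧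
        (∀ v ∈ P, dist (realPoint v) x ≤ r / 2) ∧
        (∀ v ∈ P, ∀ w ∈ P, v ≠ w → 1 / (N : ℝ) ^ (n + 1) < dist (realPoint v) (realPoint w)) ∧
        c * r ^ n * ((N : ℝ) ^ (n + 1)) ^ n ≤ P.card := by
  obtain ⟨A, hA⟩ : ∃ A : ℕ, A = 4 * 8 ^ n := ⟨_, rfl⟩
  have hA0 : 0 < A := by rw [hA]; positivity
  have hAr : (A : ℝ) = 4 * 8 ^ n := by exact_mod_cast hA
  refine ⟨1 / (2 * (4 * (A + 1)) ^ n), by positivity, fun x r hr => ?_⟩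
  have hT : Tendsto (fun N : ℕ => (N : ℝ)) atTop atTop := tendsto_natCast_atTop_atTop
  have hT' : Tendsto (fun N : ℕ => (N : ℝ) ^ n) atTop atTop :=
    (tendsto_pow_atTop (by omega)).comp hT
  filter_upwards [hT.eventually_ge_atTop (4 / r), eventually_gt_atTop 0,
    hT'.eventually_ge_atTop (4 * 8 ^ n / (r * r ^ n))] with N hN4 hN0 hNn
  have hN0' : (0 : ℝ) < N := by exact_mod_cast hN0
  have hNr : 1 / (N : ℝ) ≤ r / 4 := by
    rw [div_le_iff₀ hr] at hN4
    rw [div_le_div_iff₀ hN0' (by norm_num)]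
    linarith
  set δ : ℝ := 1 / (N : ℝ) ^ (n + 1) with hδ
  have hδ0 : 0 < δ := by positivity
  classical
  let V : Finset (Fin n → ℚ) :=
    ((Finset.range (N ^ n + 1)).biUnion fun q => gridPoints q x (r / 2)).filter fun v =>
      commonDen v ≤ N ^ n ∧ dist (realPoint v) x ≤ r / 2
  obtain ⟨P, hPV, hsep, hnet⟩ := exists_separated_subset realPoint V hδ0.le
  refine ⟨P, fun v hv => (Finset.mem_filter.1 (hPV hv)).2.1,
    fun v hv => (Finset.mem_filter.1 (hPV hv)).2.2, hsep, ?_⟩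
  have hcover : Metric.closedBall x (r / 4) ⊆
      (⋃ q ∈ Finset.Icc 1 (N ^ n / A), ⋃ v ∈ gridPoints q x (r / 2),
        Metric.closedBall (realPoint v) (1 / (q * N))) ∪
      ⋃ w ∈ P, Metric.closedBall (realPoint w) ((A + 1) * δ) := by
    intro y hy
    obtain ⟨v, hvN, hyv⟩ := exists_commonDen_le_dist_lt y hN0
    have hq := commonDen_pos v
    have hq' : (1 : ℝ) ≤ commonDen v := by exact_mod_cast hq
    have hvx : dist (realPoint v) x ≤ r / 2 := by
      have h1 : 1 / (commonDen v * (N : ℝ)) ≤ 1 / N := by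
        gcongr
        nlinarith
      have := dist_triangle_left (realPoint v) x y
      rw [Metric.mem_closedBall] at hy
      linarith
    have hgrid := mem_gridPoints (by positivity) (Metric.mem_closedBall.2 hvx)
    by_cases hsmall : commonDen v ≤ N ^ n / A
    · refine Or.inl ?_
      simp only [Set.mem_iUnion]
      exact ⟨commonDen v, Finset.mem_Icc.2 ⟨hq, hsmall⟩, v, hgrid, hyv.le⟩
    · refine Or.inr ?_
      have hvV : v ∈ V := Finset.mem_filter.2
        ⟨Finset.mem_biUnion.2 ⟨_, Finset.mem_range.2 (by omega), hgrid⟩, hvN, hvx⟩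
      obtain ⟨w, hwP, hvw⟩ := hnet v hvV
      simp only [Set.mem_iUnion]
      refine ⟨w, hwP, ?_⟩
      have hlarge : N ^ n < commonDen v * A := by
        rwa [not_le, Nat.div_lt_iff_lt_mul hA0] at hsmall
      have hlarge' : (N : ℝ) ^ n ≤ commonDen v * A := by exact_mod_cast hlarge.le
      have h2 : 1 / (commonDen v * (N : ℝ)) ≤ A * δ := by
        rw [hδ, mul_one_div, div_le_div_iff₀ (by positivity) (by positivity), pow_succ]
        nlinarith
      have := dist_triangle y (realPoint v) (realPoint w)
      rw [Metric.mem_closedBall]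
      linarith
  have hvol := (measure_mono hcover).trans (measure_union_le (μ := volume) _ _)
  rw [Real.volume_pi_closedBall _ (by positivity), Fintype.card_fin] at hvol
  have hlow : volume (⋃ q ∈ Finset.Icc 1 (N ^ n / A), ⋃ v ∈ gridPoints q x (r / 2),
        Metric.closedBall (realPoint v) (1 / (q * (N : ℝ))))
      ≤ ENNReal.ofReal ((r / 2) ^ n / 2) := by
    refine (measure_biUnion_finset_le _ _).trans ?_
    refine (Finset.sum_le_sum fun q _ =>
      volume_biUnion_closedBall_le (gridPoints q x (r / 2)) realPoint (by positivity)).trans ?_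
    rw [← ENNReal.ofReal_sum_of_nonneg fun q _ => by positivity]
    refine ENNReal.ofReal_le_ofReal ?_
    have h3 : ∀ q ∈ Finset.Icc 1 (N ^ n / A),
        ((gridPoints q x (r / 2)).card : ℝ) * (2 * (1 / (q * N))) ^ n ≤
        ((q : ℝ) * r + 1) ^ n * (2 * (1 / (q * N))) ^ n := by
      intro q _
      gcongr
      refine (card_gridPoints_le q x (by positivity)).trans_eq ?_
      congr 1
      ring
    refine (Finset.sum_le_sum h3).trans ((sum_Icc_mul_add_one_pow_le n _ N hr).trans ?_)
    have h4 : ((N ^ n / A : ℕ) : ℝ) ≤ (N : ℝ) ^ n / A := by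
      simpa using Nat.cast_div_le (α := ℝ) (m := N ^ n) (n := A)
    have h5 : (2 / (N : ℝ)) ^ n * ((N : ℝ) ^ n / A * (2 * r) ^ n) = (r / 2) ^ n / 4 := by
      rw [hAr, div_pow, div_pow, mul_pow, show (8 : ℝ) = 2 * 2 * 2 by norm_num, mul_pow, mul_pow]
      field_simp
    have h6 : (2 / (N : ℝ)) ^ n * (2 ^ n / r) ≤ (r / 2) ^ n / 4 := by
      rw [div_le_iff₀ (by positivity)] at hNn
      rw [div_pow, div_pow, div_mul_div_comm, div_div, div_le_div_iff₀ (by positivity)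
        (by positivity)]
      have : (8 : ℝ) ^ n = 2 ^ n * 2 ^ n * 2 ^ n := by rw [← mul_pow, ← mul_pow]; norm_num
      rw [this] at hNn
      linarith
    calc _ ≤ (2 / (N : ℝ)) ^ n * ((N : ℝ) ^ n / A * (2 * r) ^ n + 2 ^ n / r) := by gcongr
      _ ≤ _ := by rw [mul_add, h5]; linarith
  have htot := hvol.trans (add_le_add hlow
    (volume_biUnion_closedBall_le P realPoint (R := (A + 1) * δ) (by positivity)))
  rw [← ENNReal.ofReal_add (by positivity) (by positivity),
    ENNReal.ofReal_le_ofReal_iff (by positivity)] at htot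
  have h7 : (2 * (r / 4)) ^ n = (r / 2) ^ n := by congr 1; ring
  rw [h7] at htot
  have h8 : (r / 2) ^ n / 2 ≤ P.card * (2 * ((A + 1) * δ)) ^ n := by linarith
  have h9 : (2 * ((A + 1) * δ)) ^ n = (2 * ((A : ℝ) + 1)) ^ n / ((N : ℝ) ^ (n + 1)) ^ n := by
    rw [hδ, ← div_pow]
    congr 1
    ring
  rw [h9, ← mul_div_assoc, le_div_iff₀ (by positivity)] at h8
  have h10 : (4 * ((A : ℝ) + 1)) ^ n = 2 ^ n * (2 * ((A : ℝ) + 1)) ^ n := by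
    rw [← mul_pow]
    congr 1
    ring
  rw [h10, one_div_mul_eq_div, div_mul_eq_mul_div, div_le_iff₀ (by positivity)]
  rw [div_pow, div_div, div_mul_eq_mul_div, div_le_iff₀ (by positivity)] at h8
  linarith

lemma card_mul_pow_le_of_separated {n : ℕ} {ι : Type*} (f : ι → Fin n → ℝ) (P : Finset ι)
    {y : Fin n → ℝ} {R δ : ℝ} (hδ : 0 < δ) (hR : 0 ≤ R)
    (hsep : ∀ v ∈ P, ∀ w ∈ P, v ≠ w → δ < dist (f v) (f w))
    (hball : ∀ v ∈ P, dist (f v) y ≤ R) : P.card * δ ^ n ≤ (2 * R + δ) ^ n := by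
  have hdisj : (P : Set ι).PairwiseDisjoint fun v => Metric.closedBall (f v) (δ / 2) := by
    intro v hv w hw hvw
    refine Metric.closedBall_disjoint_closedBall ?_
    have := hsep v hv w hw hvw
    linarith
  have hsub : (⋃ v ∈ P, Metric.closedBall (f v) (δ / 2)) ⊆ Metric.closedBall y (R + δ / 2) := by
    refine Set.iUnion₂_subset fun v hv => Metric.closedBall_subset_closedBall' ?_
    have := hball v hv
    linarith
  have hvol := measure_mono (μ := volume) hsub
  rw [measure_biUnion_finset hdisj fun v _ => Metric.isClosed_closedBall.measurableSet,
    Real.volume_pi_closedBall _ (by positivity)] at hvol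
  simp only [Real.volume_pi_closedBall _ (half_pos hδ).le, Fintype.card_fin, Finset.sum_const,
    nsmul_eq_mul] at hvol
  rw [← ENNReal.ofReal_natCast, ← ENNReal.ofReal_mul (by positivity),
    ENNReal.ofReal_le_ofReal_iff (by positivity)] at hvol
  convert hvol using 2 <;> ring

open Classical in
/-- The total weight of the sets `U i` (of size at most `d i`) meeting a closed ball of radius `r`,
each of them being weighted by `(d i / r) ^ s`, truncated at `1`. -/
noncomputable def hitMass {n : ℕ} (U : ℕ → Set (Fin n → ℝ)) (d : ℕ → ℝ) (s : ℝ)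
    (x : Fin n → ℝ) (r : ℝ) : ENNReal :=
  ∑' i, if (U i ∩ Metric.closedBall x r).Nonempty then ENNReal.ofReal (min 1 ((d i / r) ^ s)) else 0

lemma ofReal_le_hitMass {n : ℕ} {U : ℕ → Set (Fin n → ℝ)} {d : ℕ → ℝ} {s : ℝ}
    {x : Fin n → ℝ} {r : ℝ} {i : ℕ} (h : (U i ∩ Metric.closedBall x r).Nonempty) :
    ENNReal.ofReal (min 1 ((d i / r) ^ s)) ≤ hitMass U d s x r := by
  classical
  have := ENNReal.le_tsum (f := fun i => if (U i ∩ Metric.closedBall x r).Nonempty then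
    ENNReal.ofReal (min 1 ((d i / r) ^ s)) else 0) i
  simpa only [hitMass, if_pos h] using this

lemma div_rpow_le_of_hitMass_le {n : ℕ} {U : ℕ → Set (Fin n → ℝ)} {d : ℕ → ℝ} {s ε : ℝ}
    {x : Fin n → ℝ} {r : ℝ} {i : ℕ} (hε0 : 0 ≤ ε) (hε : ε < 1)
    (hmass : hitMass U d s x r ≤ ENNReal.ofReal ε)
    (h : (U i ∩ Metric.closedBall x r).Nonempty) : (d i / r) ^ s ≤ ε := by
  have h1 := (ofReal_le_hitMass h).trans hmass
  rw [ENNReal.ofReal_le_ofReal_iff hε0, min_le_iff] at h1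
  exact h1.resolve_left (by linarith)

lemma card_mul_min_le_of_separated {n : ℕ} {s c η : ℝ} (hs : 0 < s) (hsn : s < n) (hη0 : 0 < η)
    (hη : η ^ (n - s) ≤ c / 5 ^ n) {U : Set (Fin n → ℝ)} {d r ρ δ : ℝ} (hd : 0 < d)
    (hr : 0 < r) (hδ : 0 < δ) (hρ : 0 < ρ) (hρδ : ρ ≤ δ)
    (hU : ∀ x ∈ U, ∀ y ∈ U, dist x y ≤ d) (hdr : (d / r) ^ s ≤ η ^ s) {P P' : Finset (Fin n → ℚ)}
    (hP' : P' ⊆ P) (hhit : ∀ v ∈ P', (U ∩ Metric.closedBall (realPoint v) ρ).Nonempty)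
    (hsep : ∀ v ∈ P, ∀ w ∈ P, v ≠ w → δ < dist (realPoint v) (realPoint w))
    (hcard : c * r ^ n / δ ^ n ≤ P.card) (hbig : 5 ^ n * (r / ρ) ^ s ≤ P.card) :
    (P'.card : ℝ) * min 1 ((d / ρ) ^ s) ≤ P.card * (d / r) ^ s := by
  rcases P'.eq_empty_or_nonempty with h0 | ⟨v₀, hv₀⟩
  · rw [h0]
    simp
    positivity
  obtain ⟨u, huU, -⟩ := hhit v₀ hv₀
  have hcount : (P'.card : ℝ) * δ ^ n ≤ (2 * (d + ρ) + δ) ^ n := by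
    refine card_mul_pow_le_of_separated realPoint P' (y := u) hδ (by positivity) ?_ ?_
    · exact fun v hv w hw => hsep v (hP' hv) w (hP' hw)
    · intro v hv
      obtain ⟨u', hu'U, hu'⟩ := hhit v hv
      have h1 := hU u' hu'U u huU
      have h2 := dist_triangle_left (realPoint v) u u'
      rw [Metric.mem_closedBall] at hu'
      linarith
  rcases le_total d δ with hdδ | hδd
  · have h5 : (P'.card : ℝ) ≤ 5 ^ n := by
      have : (2 * (d + ρ) + δ) ^ n ≤ (5 * δ) ^ n := by
        gcongr
        linarith
      rw [mul_pow] at this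
      exact le_of_mul_le_mul_right (hcount.trans this) (by positivity)
    have h6 : (d / ρ) ^ s = (d / r) ^ s * (r / ρ) ^ s := by
      rw [← Real.mul_rpow (by positivity) (by positivity)]
      congr 1
      field_simp
    calc (P'.card : ℝ) * min 1 ((d / ρ) ^ s) ≤ 5 ^ n * ((d / r) ^ s * (r / ρ) ^ s) := by
          rw [← h6]
          gcongr
          exact min_le_right _ _
      _ = 5 ^ n * (r / ρ) ^ s * (d / r) ^ s := by ring
      _ ≤ P.card * (d / r) ^ s := by gcongr
  · have h5 : (P'.card : ℝ) * δ ^ n ≤ 5 ^ n * d ^ n := by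
      rw [← mul_pow]
      refine hcount.trans ?_
      gcongr
      linarith
    have hdr' : d / r ≤ η := (Real.rpow_le_rpow_iff (by positivity) hη0.le hs).1 hdr
    have h6 : (d / r) ^ n ≤ (d / r) ^ s * (c / 5 ^ n) := by
      have : (d / r) ^ n = (d / r) ^ s * (d / r) ^ (n - s) := by
        rw [← Real.rpow_add (by positivity), ← Real.rpow_natCast]
        congr 1
        ring
      rw [this]
      gcongr
      refine le_trans ?_ hη
      exact Real.rpow_le_rpow (by positivity) hdr' (by linarith)
    calc (P'.card : ℝ) * min 1 ((d / ρ) ^ s) ≤ P'.card :=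
          mul_le_of_le_one_right (Nat.cast_nonneg _) (min_le_left _ _)
      _ ≤ 5 ^ n * d ^ n / δ ^ n := by rwa [le_div_iff₀ (by positivity)]
      _ = 5 ^ n * r ^ n / δ ^ n * (d / r) ^ n := by
          rw [div_pow]
          field_simp
      _ ≤ 5 ^ n * r ^ n / δ ^ n * ((d / r) ^ s * (c / 5 ^ n)) := by gcongr
      _ = c * r ^ n / δ ^ n * (d / r) ^ s := by field_simp
      _ ≤ P.card * (d / r) ^ s := by gcongr

lemma exists_hitMass_le {n : ℕ} {s ε : ℝ} (hε0 : 0 ≤ ε) (hε : ε < 1)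
    {U : ℕ → Set (Fin n → ℝ)} {d : ℕ → ℝ} {x : Fin n → ℝ} {r ρ : ℝ}
    (hmass : hitMass U d s x r ≤ ENNReal.ofReal ε) {P : Finset (Fin n → ℚ)} (hP : P.Nonempty)
    (hsub : ∀ v ∈ P, Metric.closedBall (realPoint v) ρ ⊆ Metric.closedBall x r)
    (hcount : ∀ i, (d i / r) ^ s ≤ ε → ∀ P' ⊆ P,
      (∀ v ∈ P', (U i ∩ Metric.closedBall (realPoint v) ρ).Nonempty) →
      (P'.card : ℝ) * min 1 ((d i / ρ) ^ s) ≤ P.card * (d i / r) ^ s) :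
    ∃ v ∈ P, hitMass U d s (realPoint v) ρ ≤ ENNReal.ofReal ε := by
  classical
  by_contra! hlt
  have h1 := ENNReal.sum_lt_sum_of_nonempty hP hlt
  refine absurd h1 (not_lt.2 ?_)
  rw [Finset.sum_const, nsmul_eq_mul]
  refine le_trans ?_ (mul_le_mul_right hmass (P.card : ENNReal))
  simp only [hitMass]
  rw [← Summable.tsum_finsetSum fun _ _ => ENNReal.summable, ← ENNReal.tsum_mul_left]
  refine ENNReal.tsum_le_tsum fun i => ?_
  rw [← Finset.sum_filter, Finset.sum_const, nsmul_eq_mul]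
  split_ifs with hi
  · have h2 := div_rpow_le_of_hitMass_le hε0 hε hmass hi
    rw [min_eq_right (h2.trans hε.le), ← ENNReal.ofReal_natCast, ← ENNReal.ofReal_natCast P.card,
      ← ENNReal.ofReal_mul (Nat.cast_nonneg _), ← ENNReal.ofReal_mul (Nat.cast_nonneg _)]
    refine ENNReal.ofReal_le_ofReal (hcount i h2 _ (Finset.filter_subset _ _) fun v hv => ?_)
    exact (Finset.mem_filter.1 hv).2
  · rw [Finset.filter_eq_empty_iff.2]
    · simp
    · intro v hv hne
      exact hi (hne.mono (Set.inter_subset_inter_right _ (hsub v hv)))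

lemma exists_shrinking_constant {n : ℕ} (hn : 1 ≤ n) {s τ : ℝ} (hs : 0 < s) (hsn : s < n)
    (hτs : τ * s < n + 1) (hτ : ((n : ℝ) + 1) / n ≤ τ) :
    ∃ ε : ℝ, 0 < ε ∧ ε < 1 ∧ ∀ (U : ℕ → Set (Fin n → ℝ)) (d : ℕ → ℝ), (∀ i, 0 < d i) →
      (∀ i, ∀ x ∈ U i, ∀ y ∈ U i, dist x y ≤ d i) → ∀ (x : Fin n → ℝ) (r : ℝ), 0 < r →
      hitMass U d s x r ≤ ENNReal.ofReal ε →
      ∃ (v : Fin n → ℚ) (ρ : ℝ), 0 < ρ ∧ ρ ≤ r / 2 ∧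
        Metric.closedBall (realPoint v) ρ ⊆ Metric.closedBall x r ∧
        ρ < (commonDen v : ℝ) ^ (-τ) ∧ hitMass U d s (realPoint v) ρ ≤ ENNReal.ofReal ε := by
  obtain ⟨c, hc, hsepr⟩ := exists_separated_rationals hn
  have hn0 : (0 : ℝ) < n := by exact_mod_cast hn
  have hτ0 : 0 < τ := lt_of_lt_of_le (by positivity) hτ
  have hnτ : (n : ℝ) + 1 ≤ n * τ := by
    rw [div_le_iff₀ hn0] at hτ
    linarith
  have hsn' : 0 < (n : ℝ) - s := by linarith
  obtain ⟨η, hη0, hη1, hη⟩ : ∃ η : ℝ, 0 < η ∧ η < 1 ∧ η ^ (n - s) ≤ c / 5 ^ n := by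
    refine ⟨min (1 / 2) ((c / 5 ^ n) ^ (1 / ((n : ℝ) - s))), by positivity,
      (min_le_left _ _).trans_lt (by norm_num), ?_⟩
    refine (Real.rpow_le_rpow (by positivity) (min_le_right _ _) hsn'.le).trans_eq ?_
    rw [← Real.rpow_mul (by positivity), one_div_mul_cancel hsn'.ne', Real.rpow_one]
  have hε1 : η ^ s < 1 := Real.rpow_lt_one hη0.le hη1 hs
  refine ⟨η ^ s, by positivity, hε1, fun U d hd hU x r hr hmass => ?_⟩
  have hT : Tendsto (fun N : ℕ => (N : ℝ)) atTop atTop := tendsto_natCast_atTop_atTop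
  have hgrow : Tendsto (fun N : ℕ => (N : ℝ) ^ (n * (n + 1 - τ * s))) atTop atTop :=
    (tendsto_rpow_atTop (mul_pos hn0 (by linarith))).comp hT
  have hdecay : Tendsto (fun N : ℕ => (N : ℝ) ^ (-(n * τ))) atTop (nhds 0) :=
    (tendsto_rpow_neg_atTop (by positivity)).comp hT
  obtain ⟨N, ⟨P, hden, hdist, hsep, hcard⟩, hN0, hNbig, hNr⟩ := ((hsepr x r hr).and
    ((eventually_gt_atTop 0).and ((hgrow.eventually_ge_atTop
      (5 ^ n * (2 * r) ^ s / (c * r ^ n))).and (hdecay.eventually_le_const hr)))).exists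
  have hN : (0 : ℝ) < N := by exact_mod_cast hN0
  have hN1 : (1 : ℝ) ≤ N := by exact_mod_cast hN0
  obtain ⟨ρ, hρ⟩ : ∃ ρ : ℝ, ρ = (N : ℝ) ^ (-(n * τ)) / 2 := ⟨_, rfl⟩
  have hρ0 : 0 < ρ := by rw [hρ]; positivity
  have hρr : ρ ≤ r / 2 := by rw [hρ]; linarith
  have hρδ : ρ ≤ 1 / (N : ℝ) ^ (n + 1) := by
    have h1 : (N : ℝ) ^ (-(n * τ)) ≤ 1 / (N : ℝ) ^ (n + 1) := by
      rw [one_div, ← Real.rpow_natCast, ← Real.rpow_neg hN.le]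
      refine Real.rpow_le_rpow_of_exponent_le hN1 ?_
      push_cast
      linarith
    have h2 : 0 < (N : ℝ) ^ (-(n * τ)) := by positivity
    rw [hρ]
    linarith
  have hδ : c * r ^ n / (1 / (N : ℝ) ^ (n + 1)) ^ n = c * r ^ n * ((N : ℝ) ^ (n + 1)) ^ n := by
    rw [one_div, inv_pow, div_inv_eq_mul]
  have hbig : 5 ^ n * (r / ρ) ^ s ≤ P.card := by
    refine le_trans ?_ hcard
    have h1 : (r / ρ) ^ s = (2 * r) ^ s * (N : ℝ) ^ (n * τ * s) := by
      rw [Real.rpow_mul hN.le, ← Real.mul_rpow (by positivity) (by positivity), hρ,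
        Real.rpow_neg hN.le]
      congr 1
      field_simp
    have h2 : ((N : ℝ) ^ (n + 1)) ^ n =
        (N : ℝ) ^ (n * τ * s) * (N : ℝ) ^ (n * (n + 1 - τ * s)) := by
      rw [← pow_mul, ← Real.rpow_natCast, ← Real.rpow_add hN]
      congr 1
      push_cast
      ring
    rw [div_le_iff₀ (by positivity)] at hNbig
    have h3 : 0 ≤ (N : ℝ) ^ (n * τ * s) := by positivity
    rw [h1, h2]
    nlinarith [mul_le_mul_of_nonneg_left hNbig h3]
  have hPne : P.Nonempty := by
    rw [← Finset.card_pos]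
    have : (0 : ℝ) < P.card := lt_of_lt_of_le (by positivity) hcard
    exact_mod_cast this
  have hsub : ∀ v ∈ P, Metric.closedBall (realPoint v) ρ ⊆ Metric.closedBall x r := by
    intro v hv
    refine Metric.closedBall_subset_closedBall' ?_
    have := hdist v hv
    linarith
  obtain ⟨v, hvP, hv⟩ := exists_hitMass_le (by positivity) hε1 hmass hPne hsub
    fun i hi P' hP' hhit => card_mul_min_le_of_separated hs hsn hη0 hη (hd i) hr
      (by positivity) hρ0 hρδ (hU i) hi hP' hhit hsep (hδ.trans_le hcard) hbig
  refine ⟨v, ρ, hρ0, hρr, hsub v hvP, ?_, hv⟩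
  have hv0 : (0 : ℝ) < commonDen v := by exact_mod_cast commonDen_pos v
  have h1 : (commonDen v : ℝ) ≤ (N : ℝ) ^ n := by exact_mod_cast hden v hvP
  have h2 : (N : ℝ) ^ (-(n * τ)) ≤ (commonDen v : ℝ) ^ (-τ) := by
    have : (N : ℝ) ^ (-(n * τ)) = ((N : ℝ) ^ n) ^ (-τ) := by
      rw [← Real.rpow_natCast, ← Real.rpow_mul hN.le]
      congr 1
      ring
    rw [this]
    exact Real.rpow_le_rpow_of_nonpos hv0 h1 (by linarith)
  have h3 : 0 < (N : ℝ) ^ (-(n * τ)) := by positivity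
  rw [hρ]
  linarith

/-- A set of zero `s`-dimensional Hausdorff measure has covers of arbitrarily small total weight,
by sets whose sizes are bounded by positive numbers. -/
lemma exists_cover_of_hausdorffMeasure_eq_zero {X : Type*} [MetricSpace X]
    [MeasurableSpace X] [BorelSpace X] {s : ℝ} (hs : 0 < s) {T : Set X}
    (hT : Measure.hausdorffMeasure s T = 0) {ε : ENNReal} (hε : 0 < ε) :
    ∃ (U : ℕ → Set X) (d : ℕ → ℝ), T ⊆ ⋃ i, U i ∧ (∀ i, 0 < d i) ∧
      (∀ i, ∀ x ∈ U i, ∀ y ∈ U i, dist x y ≤ d i) ∧ ∑' i, ENNReal.ofReal (d i ^ s) ≤ ε := by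
  wlog hεtop : ε ≠ ⊤ generalizing ε
  · obtain ⟨U, d, h1, h2, h3, h4⟩ := this (ε := 1) (by simp) (by simp)
    rw [not_not] at hεtop
    exact ⟨U, d, h1, h2, h3, by rw [hεtop]; exact le_top⟩
  have hε2 : 0 < ε / 2 := ENNReal.half_pos hε.ne'
  obtain ⟨e, he0, he⟩ := ENNReal.exists_pos_sum_of_countable hε2.ne' ℕ
  rw [Measure.hausdorffMeasure_apply] at hT
  have h1 := le_iSup₂ (f := fun (r : ENNReal) (_ : 0 < r) =>
    ⨅ (t : ℕ → Set X) (_ : T ⊆ ⋃ n, t n) (_ : ∀ n, Metric.ediam (t n) ≤ r),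
      ∑' n, ⨆ _ : (t n).Nonempty, Metric.ediam (t n) ^ s) 1 one_pos
  rw [hT] at h1
  have h2 := h1.trans_lt hε2
  simp only [iInf_lt_iff] at h2
  obtain ⟨U, hTU, -, hsum⟩ := h2
  let w : ℕ → ENNReal := fun i => (⨆ _ : (U i).Nonempty, Metric.ediam (U i) ^ s) + e i
  have hw : ∑' i, w i ≤ ε := by
    rw [ENNReal.tsum_add, ← ENNReal.add_halves ε]
    exact add_le_add hsum.le he.le
  have hwtop : ∀ i, w i ≠ ⊤ := fun i =>
    ((ENNReal.le_tsum i).trans hw).trans_lt hεtop.lt_top |>.ne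
  have hw0 : ∀ i, 0 < (w i).toReal := fun i => ENNReal.toReal_pos
    (by simp [w, (he0 i).ne']) (hwtop i)
  refine ⟨U, fun i => (w i).toReal ^ (1 / s), hTU, fun i => Real.rpow_pos_of_pos (hw0 i) _, ?_, ?_⟩
  · intro i x hx y hy
    have h3 : edist x y ^ s ≤ w i := by
      refine le_trans ?_ le_self_add
      rw [ciSup_pos ⟨x, hx⟩]
      exact ENNReal.rpow_le_rpow (Metric.edist_le_ediam_of_mem hx hy) hs.le
    beta_reduce
    rw [ENNReal.toReal_rpow, dist_edist]
    refine ENNReal.toReal_mono (ENNReal.rpow_ne_top_of_nonneg (by positivity) (hwtop i)) ?_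
    rwa [one_div, ENNReal.le_rpow_inv_iff hs]
  · refine le_trans (ENNReal.tsum_le_tsum fun i => ?_) hw
    rw [← Real.rpow_mul (hw0 i).le, one_div_mul_cancel hs.ne', Real.rpow_one,
      ENNReal.ofReal_toReal (hwtop i)]

lemma hausdorffMeasure_Wapprox_ne_zero {n : ℕ} (hn : 1 ≤ n) {s τ : ℝ} (hs : 0 < s) (hsn : s < n)
    (hτs : τ * s < n + 1) (hτ : ((n : ℝ) + 1) / n ≤ τ) :
    Measure.hausdorffMeasure s (Wapprox n fun q => (q : ℝ) ^ (-τ)) ≠ 0 := by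
  intro hzero
  set W := Wapprox n fun q => (q : ℝ) ^ (-τ)
  have hT : Measure.hausdorffMeasure s (W ∪ Set.range (realPoint (n := n))) = 0 := by
    refine measure_union_null hzero ?_
    have := Measure.nullSingletonClass_hausdorff (Fin n → ℝ) hs
    exact (Set.countable_range _).measure_zero _
  obtain ⟨ε, hε0, hε1, hstep⟩ := exists_shrinking_constant hn hs hsn hτs hτ
  obtain ⟨U, d, hTU, hd, hU, hsum⟩ :=
    exists_cover_of_hausdorffMeasure_eq_zero hs hT (ENNReal.ofReal_pos.2 hε0)
  have hinit : hitMass U d s 0 1 ≤ ENNReal.ofReal ε := by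
    refine le_trans (ENNReal.tsum_le_tsum fun i => ?_) hsum
    split_ifs
    · rw [div_one]
      exact ENNReal.ofReal_le_ofReal (min_le_right _ _)
    · exact zero_le
  let S := {p : (Fin n → ℝ) × ℝ // 0 < p.2 ∧ hitMass U d s p.1 p.2 ≤ ENNReal.ofReal ε}
  have hnext (p : S) : ∃ (q : S) (v : Fin n → ℚ), q.1.1 = realPoint v ∧ q.1.2 ≤ p.1.2 / 2 ∧
      Metric.closedBall q.1.1 q.1.2 ⊆ Metric.closedBall p.1.1 p.1.2 ∧
      q.1.2 < (commonDen v : ℝ) ^ (-τ) := by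
    obtain ⟨v, ρ, h1, h2, h3, h4, h5⟩ := hstep U d hd hU p.1.1 p.1.2 p.2.1 p.2.2
    exact ⟨⟨(realPoint v, ρ), h1, h5⟩, v, rfl, h2, h3, h4⟩
  choose f v hfv hhalf hsub hden using hnext
  let B : ℕ → S := fun k => f^[k] ⟨(0, 1), one_pos, hinit⟩
  have hB (k : ℕ) : B (k + 1) = f (B k) := Function.iterate_succ_apply' f k _
  have hrad (k : ℕ) : (B k).1.2 ≤ (1 / 2) ^ k := by
    induction k with
    | zero => simp [B]
    | succ k ih =>
      have := hhalf (B k)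
      rw [hB, pow_succ]
      linarith
  have hrad0 : Tendsto (fun k => (B k).1.2) atTop (nhds 0) :=
    squeeze_zero (fun k => (B k).2.1.le) hrad
      (tendsto_pow_atTop_nhds_zero_of_lt_one (by norm_num) (by norm_num))
  obtain ⟨x, hx⟩ := IsCompact.nonempty_iInter_of_sequence_nonempty_isCompact_isClosed
    (fun k => Metric.closedBall (B k).1.1 (B k).1.2) (fun k => by rw [hB]; exact hsub (B k))
    (fun k => Metric.nonempty_closedBall.2 (B k).2.1.le) (isCompact_closedBall _ _)
    (fun k => Metric.isClosed_closedBall)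
  rw [Set.mem_iInter] at hx
  have hxT : x ∉ W ∪ Set.range (realPoint (n := n)) := by
    intro hxT
    obtain ⟨i, hi⟩ := Set.mem_iUnion.1 (hTU hxT)
    refine (hd i).not_ge (ge_of_tendsto' hrad0 fun k => ?_)
    have h1 := (div_rpow_le_of_hitMass_le hε0.le hε1 (B k).2.2 ⟨x, hi, hx k⟩).trans hε1.le
    have hr := (B k).2.1
    rw [Real.rpow_le_one_iff_of_pos (div_pos (hd i) hr)] at h1
    rcases h1 with h1 | h1
    · linarith [h1.2]
    · exact (div_le_one hr).1 h1.1
  rw [Set.mem_union, not_or] at hxT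
  have hclose (k : ℕ) : dist x (realPoint (v (B k))) ≤ (B (k + 1)).1.2 := by
    have := hx (k + 1)
    rwa [Metric.mem_closedBall, hB, hfv, ← hB] at this
  refine hxT.1 fun hfin => hxT.2 ?_
  have hmem (k : ℕ) : v (B k) ∈ {v : Fin n → ℚ |
      ‖x - fun i => (v i : ℝ)‖ < ((Finset.univ.lcm fun i => (v i).den : ℕ) : ℝ) ^ (-τ)} := by
    have := hden (B k)
    rw [← hB] at this
    exact (dist_eq_norm x _).symm.trans_lt ((hclose k).trans_lt this)
  obtain ⟨v₀, -, hmin⟩ := Set.exists_min_image _ (fun v => dist x (realPoint v)) hfin ⟨_, hmem 0⟩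
  have hle : dist x (realPoint v₀) ≤ 0 :=
    ge_of_tendsto' (hrad0.comp (tendsto_add_atTop_nat 1)) fun k =>
      (hmin _ (hmem k)).trans (hclose k)
  exact ⟨v₀, (dist_le_zero.1 hle).symm⟩

lemma hausdorffMeasure_Wapprox_eq_zero {n : ℕ} {s τ : ℝ} (hs : 0 < s) (hτ : 0 < τ)
    (hτs : n + 1 < τ * s) :
    Measure.hausdorffMeasure s (Wapprox n fun q => (q : ℝ) ^ (-τ)) = 0 := by
  set W := Wapprox n fun q => (q : ℝ) ^ (-τ)
  have hunion : W = ⋃ m : ℕ, W ∩ Metric.closedBall 0 m := by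
    rw [← Set.inter_iUnion, Metric.iUnion_closedBall_nat, Set.inter_univ]
  rw [hunion]
  refine measure_iUnion_null fun m => ?_
  let F : ℕ → ENNReal := fun j =>
    ENNReal.ofReal ((2 * m + 3) ^ n * 2 ^ s * ((j + 1 : ℕ) : ℝ) ^ (n - τ * s))
  have hF : ∑' j, F j ≠ ⊤ := by
    refine Summable.tsum_ofReal_ne_top (Summable.mul_left _ ?_)
    exact (summable_nat_add_iff (f := fun j : ℕ => (j : ℝ) ^ (n - τ * s)) 1).2
      (Real.summable_nat_rpow.2 (by linarith))
  let t : ∀ k : ℕ, (Σ j : ℕ, gridPoints (n := n) (j + k + 1) 0 (m + 1)) → Set (Fin n → ℝ) :=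
    fun k a => Metric.closedBall (realPoint a.2.1) (((a.1 + k + 1 : ℕ) : ℝ) ^ (-τ))
  have hdiam (k : ℕ) (a) :
      Metric.ediam (t k a) ≤ ENNReal.ofReal (2 * ((a.1 + k + 1 : ℕ) : ℝ) ^ (-τ)) := by
    simp only [t]
    rw [Metric.ediam_le_iff]
    intro y hy z hz
    rw [edist_dist]
    refine ENNReal.ofReal_le_ofReal ?_
    have := dist_triangle_right y z (realPoint a.2.1)
    rw [Metric.mem_closedBall] at hy hz
    linarith
  have hr : Tendsto (fun k : ℕ => ENNReal.ofReal (2 * ((k + 1 : ℕ) : ℝ) ^ (-τ))) atTop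
      (nhds 0) := by
    rw [← ENNReal.ofReal_zero, ← mul_zero (2 : ℝ)]
    refine ENNReal.tendsto_ofReal (Tendsto.const_mul _ ?_)
    exact (tendsto_rpow_neg_atTop hτ).comp
      (tendsto_natCast_atTop_atTop.comp (tendsto_add_atTop_nat 1))
  have hcover (k : ℕ) : W ∩ Metric.closedBall 0 m ⊆ ⋃ a, t k a := by
    rintro x ⟨hxW, hxm⟩
    obtain ⟨v, hv, hvk⟩ := Set.Infinite.exists_notMem_finset hxW
      ((Finset.range (k + 1)).biUnion fun q => gridPoints q 0 (m + 1))
    have hv' : dist x (realPoint v) < (commonDen v : ℝ) ^ (-τ) := (dist_eq_norm x _).trans_lt hv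
    have hone : (commonDen v : ℝ) ^ (-τ) ≤ 1 :=
      Real.rpow_le_one_of_one_le_of_nonpos (by exact_mod_cast commonDen_pos v) (by linarith)
    have hgrid : v ∈ gridPoints (commonDen v) 0 (m + 1) := by
      refine mem_gridPoints (by positivity) ?_
      have := dist_triangle_left (realPoint v) 0 x
      rw [Metric.mem_closedBall] at hxm ⊢
      linarith
    have hk : k + 1 ≤ commonDen v := by
      by_contra! hlt
      exact hvk (Finset.mem_biUnion.2 ⟨_, Finset.mem_range.2 hlt, hgrid⟩)
    obtain ⟨j, hj⟩ := Nat.exists_eq_add_of_le hk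
    have hj' : commonDen v = j + k + 1 := by omega
    rw [hj'] at hgrid hv'
    exact Set.mem_iUnion.2 ⟨⟨j, v, hgrid⟩, Metric.mem_closedBall.2 hv'.le⟩
  have hsum (k : ℕ) : ∑' a, Metric.ediam (t k a) ^ s ≤ ∑' j, F (j + k) := by
    rw [ENNReal.tsum_sigma']
    refine ENNReal.tsum_le_tsum fun j => ?_
    refine (ENNReal.tsum_le_tsum fun v =>
      ENNReal.rpow_le_rpow (hdiam k ⟨j, v⟩) hs.le).trans ?_
    have hq1 : (1 : ℝ) ≤ (j + k + 1 : ℕ) := by exact_mod_cast Nat.le_add_left 1 (j + k)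
    have hq0 : (0 : ℝ) < (j + k + 1 : ℕ) := by linarith
    have hball : 0 < 2 * ((j + k + 1 : ℕ) : ℝ) ^ (-τ) :=
      mul_pos two_pos (Real.rpow_pos_of_pos hq0 _)
    dsimp only
    rw [tsum_fintype, Finset.sum_const, nsmul_eq_mul, Finset.card_univ, Fintype.card_coe,
      ENNReal.ofReal_rpow_of_pos hball, ← ENNReal.ofReal_natCast,
      ← ENNReal.ofReal_mul (Nat.cast_nonneg _)]
    refine ENNReal.ofReal_le_ofReal ?_
    have hcard : ((gridPoints (n := n) (j + k + 1) 0 (m + 1)).card : ℝ) ≤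
        (2 * m + 3) ^ n * ((j + k + 1 : ℕ) : ℝ) ^ (n : ℝ) := by
      refine (card_gridPoints_le _ _ (by positivity)).trans ?_
      rw [Real.rpow_natCast, ← mul_pow]
      gcongr
      linarith
    have hpow : (2 * ((j + k + 1 : ℕ) : ℝ) ^ (-τ)) ^ s =
        2 ^ s * ((j + k + 1 : ℕ) : ℝ) ^ (-(τ * s)) := by
      rw [Real.mul_rpow (by positivity) (by positivity), ← Real.rpow_mul hq0.le, neg_mul]
    rw [hpow, sub_eq_add_neg, Real.rpow_add hq0]
    calc _ ≤ (2 * m + 3) ^ n * ((j + k + 1 : ℕ) : ℝ) ^ (n : ℝ) *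
          (2 ^ s * ((j + k + 1 : ℕ) : ℝ) ^ (-(τ * s))) := by gcongr
      _ = _ := by ring
  have hle := Measure.hausdorffMeasure_le_liminf_tsum s (W ∩ Metric.closedBall 0 m) _ hr t
    (Eventually.of_forall fun k a => (hdiam k a).trans (ENNReal.ofReal_le_ofReal ?_))
    (Eventually.of_forall hcover)
  · have hlim : Tendsto (fun k => ∑' a, Metric.ediam (t k a) ^ s) atTop (nhds 0) :=
      tendsto_of_tendsto_of_tendsto_of_le_of_le tendsto_const_nhds
        (ENNReal.tendsto_sum_nat_add F hF) (fun _ => zero_le) hsum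
    rw [hlim.liminf_eq] at hle
    exact le_antisymm hle zero_le
  · have : ((k + 1 : ℕ) : ℝ) ≤ (a.1 + k + 1 : ℕ) := by exact_mod_cast (by omega)
    refine mul_le_mul_of_nonneg_left ?_ zero_le_two
    exact Real.rpow_le_rpow_of_nonpos (by positivity) this (by linarith)

/-- Jarník's theorem: for `τ ≥ (n+1)/n`, `dim_H W(s ↦ s^{-τ}) = (n+1)/τ`. -/
theorem jarnik (n : ℕ) (hn : 1 ≤ n) (τ : ℝ) (hτ : ((n : ℝ) + 1) / n ≤ τ) :
    dimH (Wapprox n (fun q => (q : ℝ) ^ (-τ)))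
      = ENNReal.ofReal (((n : ℝ) + 1) / τ) := by
  have hn0 : (0 : ℝ) < n := by exact_mod_cast hn
  have hτ0 : 0 < τ := lt_of_lt_of_le (by positivity) hτ
  refine le_antisymm (le_of_not_gt fun hlt => ?_) (le_of_not_gt fun hlt => ?_)
  · obtain ⟨s, hs1, hs2⟩ := ENNReal.lt_iff_exists_nnreal_btwn.1 hlt
    have hs : ((n : ℝ) + 1) / τ < s := by
      rwa [← ENNReal.ofReal_coe_nnreal, ENNReal.ofReal_lt_ofReal_iff_of_nonneg (by positivity)]
        at hs1
    have htop := hausdorffMeasure_of_lt_dimH hs2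
    rw [hausdorffMeasure_Wapprox_eq_zero (lt_trans (by positivity) hs) hτ0] at htop
    · exact ENNReal.zero_ne_top htop
    · rwa [div_lt_iff₀' hτ0] at hs
  · obtain ⟨s, hs1, hs2⟩ := ENNReal.lt_iff_exists_nnreal_btwn.1 hlt
    have hs0 : (0 : ℝ) < s := by exact_mod_cast hs1.pos
    have hs : s < ((n : ℝ) + 1) / τ := by
      rwa [← ENNReal.ofReal_coe_nnreal, ENNReal.ofReal_lt_ofReal_iff (by positivity)] at hs2
    refine hausdorffMeasure_Wapprox_ne_zero hn hs0 (hs.trans_le ?_) ?_ hτ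
      (hausdorffMeasure_of_dimH_lt hs1)
    · rw [div_le_iff₀ hτ0, mul_comm]
      rwa [div_le_iff₀ hn0] at hτ
    · rwa [lt_div_iff₀' hτ0] at hs
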